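/- arXiv:1806.01955 — 7 statements merged into one kernel-verified Lean document; each statement's English description precedes it below -/
import Mathlib

section
/- Let H be a Hilbert space of V-valued functions on D admitting a reproducing kernel K, let V₁ be another finite-dimensional complex inner product space, and let T be a linear map from H to the space of all functions D → V₁ such that for every z ∈ D the linear map A_z : H → V₁, A_z f = (Tf)(z), is bounded. Then: (a) the kernel of T is a closed subspace of H; (b) the image T(H), equipped with the inner product transferred from the quotient H/ker T (equivalently, from the orthogonal complement of ker T) via the bijection induced by T, is a Hilbert space of V₁-valued functions on D whose reproducing kernel is K'(z,w) = A_z ∘ A_w^*, where A_w^* : V₁ → H is the Hilbert-space adjoint of A_w. -/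
open scoped InnerProductSpace

/-- Let `H` be a Hilbert space of `V`-valued functions on `D` (realized via an
injective linear inclusion `ι` into the functions `D → V`) admitting a reproducing kernel `K`
(with representers `kfun`).  Let `V₁` be another finite-dimensional complex inner product space
and `T` a linear map from `H` to functions `D → V₁` whose point evaluations `A z : H → V₁`,
`A z f = T f z`, are all bounded.  Then (a) `ker T` is closed, the transferred Hilbert structure
on `T(H)` (via the bijection of `(ker T)ᗮ` with `T(H)`) is well defined, and (b) the functions
`z ↦ (A z ∘ (A w)⋆) v` have representers `(A w)⋆ v ∈ (ker T)ᗮ` satisfying the reproducing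
property for the transferred inner product, i.e. `K'(z,w) = A z ∘ (A w)⋆` is the reproducing
kernel of `T(H)`. -/
theorem stmt_0
    {D : Type*} [Nonempty D]
    {V : Type*} [NormedAddCommGroup V] [InnerProductSpace ℂ V] [FiniteDimensional ℂ V]
    {V₁ : Type*} [NormedAddCommGroup V₁] [InnerProductSpace ℂ V₁] [FiniteDimensional ℂ V₁]
    {H : Type*} [NormedAddCommGroup H] [InnerProductSpace ℂ H] [CompleteSpace H]
    (ι : H →ₗ[ℂ] (D → V)) (hι : Function.Injective ι)
    -- reproducing kernel data for `H`
    (K : D → D → (V →L[ℂ] V)) (kfun : D → V → H)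
    (hKrep : ∀ (w : D) (v : V), ι (kfun w v) = fun z => K z w v)
    (hKprop : ∀ (w : D) (v : V) (f : H), ⟪kfun w v, f⟫_ℂ = ⟪v, ι f w⟫_ℂ)
    -- `T` and its bounded point evaluations
    (T : H →ₗ[ℂ] (D → V₁)) (A : D → (H →L[ℂ] V₁))
    (hA : ∀ (z : D) (f : H), A z f = T f z) :
    -- (a) the kernel of `T` is a closed subspace of `H`
    IsClosed (LinearMap.ker T : Set H) ∧
    -- the transferred Hilbert structure on the image is well defined:
    -- `T` restricted to `(ker T)ᗮ` is a bijection onto the range of `T`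
    (∀ g ∈ Set.range T, ∃! f, f ∈ (LinearMap.ker T)ᗮ ∧ T f = g) ∧
    -- (b) the representers `(A w)⋆ v` lie in `(ker T)ᗮ` ...
    (∀ (w : D) (v : V₁),
      ContinuousLinearMap.adjoint (A w) v ∈ (LinearMap.ker T)ᗮ) ∧
    -- ... their images under `T` are the functions `z ↦ K'(z,w) v` with
    -- `K'(z,w) = A z ∘ (A w)⋆` ...
    (∀ (w : D) (v : V₁),
      T (ContinuousLinearMap.adjoint (A w) v)
        = fun z => ((A z).comp (ContinuousLinearMap.adjoint (A w))) v) ∧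
    -- ... and they satisfy the reproducing property with respect to the inner product
    -- transferred from `(ker T)ᗮ ≅ H / ker T`
    (∀ (w : D) (v : V₁), ∀ f ∈ (LinearMap.ker T)ᗮ,
      ⟪ContinuousLinearMap.adjoint (A w) v, f⟫_ℂ = ⟪v, T f w⟫_ℂ) := by
  have hclosed : IsClosed (LinearMap.ker T : Set H) := by
    have hker : (LinearMap.ker T : Set H) = ⋂ z, {f | A z f = 0} := by
      ext f
      simp [hA, funext_iff]
    rw [hker]
    exact isClosed_iInter fun z => isClosed_eq (A z).continuous continuous_const
  refine ⟨hclosed, ?_, ?_, ?_, ?_⟩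
  · rintro _ ⟨f, rfl⟩
    have : CompleteSpace (LinearMap.ker T) := hclosed.completeSpace_coe
    obtain ⟨y, hy, z, hz, rfl⟩ := (LinearMap.ker T).exists_add_mem_mem_orthogonal f
    refine ⟨z, ⟨hz, by rw [map_add, LinearMap.mem_ker.mp hy, zero_add]⟩, ?_⟩
    rintro x ⟨hx, hxz⟩
    rw [map_add, LinearMap.mem_ker.mp hy, zero_add] at hxz
    have hsub : x - z ∈ LinearMap.ker T := by
      rw [LinearMap.mem_ker, map_sub, hxz, sub_self]
    exact sub_eq_zero.mp <| inner_self_eq_zero.mp <|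
      (LinearMap.ker T).inner_right_of_mem_orthogonal hsub (Submodule.sub_mem _ hx hz)
  · intro w v
    rw [Submodule.mem_orthogonal]
    intro u hu
    rw [ContinuousLinearMap.adjoint_inner_right, hA, LinearMap.mem_ker.mp hu, Pi.zero_apply,
      inner_zero_left]
  · intro w v
    funext z
    rw [ContinuousLinearMap.comp_apply, hA]
  · intro w v f _
    rw [ContinuousLinearMap.adjoint_inner_left, hA]
end

section
/- Let H be a Hilbert space of V-valued functions on D with reproducing kernel K, and let T be a linear map from H to the space of all functions D → V₁ such that for every z ∈ D the linear map A_z : H → V₁, A_z f = (Tf)(z), is bounded. Let H₁ be a Hilbert space of V₁-valued functions on D with reproducing kernel K₁, and let c > 0. Then T maps H into H₁ and is bounded with operator norm at most c if and only if the End(V₁)-valued kernel (z,w) ↦ c² K₁(z,w) − A_z ∘ A_w^* is positive semidefinite, where A_w^* : V₁ → H is the Hilbert-space adjoint of A_w. -/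
open scoped InnerProductSpace ComplexOrder

section Kernel

variable {D V E F : Type*} [NormedAddCommGroup V] [InnerProductSpace ℂ V]
  [NormedAddCommGroup E] [InnerProductSpace ℂ E] [NormedAddCommGroup F] [InnerProductSpace ℂ F]

/-- Kernel sections having the reproducing property depend linearly on the vector. -/
def kernelSection (ι : E →ₗ[ℂ] (D → V)) (k : D → V → E)
    (hk : ∀ (w : D) (v : V) (f : E), ⟪k w v, f⟫_ℂ = ⟪v, ι f w⟫_ℂ) (w : D) : V →ₗ[ℂ] E where
  toFun := k w
  map_add' u v := ext_inner_right ℂ fun f => by simp [hk, inner_add_left]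
  map_smul' a v := ext_inner_right ℂ fun f => by simp [hk, inner_smul_left, mul_comm]

@[simp]
theorem kernelSection_apply (ι : E →ₗ[ℂ] (D → V)) (k : D → V → E)
    (hk : ∀ (w : D) (v : V) (f : E), ⟪k w v, f⟫_ℂ = ⟪v, ι f w⟫_ℂ) (w : D) (v : V) :
    kernelSection ι k hk w v = k w v :=
  rfl

/-- The linear span of the kernel sections is dense. -/
theorem denseRange_lsum_kernelSection [CompleteSpace E] (ι : E →ₗ[ℂ] (D → V))
    (hι : Function.Injective ι) (k : D → V → E)
    (hk : ∀ (w : D) (v : V) (f : E), ⟪k w v, f⟫_ℂ = ⟪v, ι f w⟫_ℂ) :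
    DenseRange (Finsupp.lsum ℂ (kernelSection ι k hk)) := by
  have h : (LinearMap.range (Finsupp.lsum ℂ (kernelSection ι k hk))).topologicalClosure = ⊤ := by
    rw [Submodule.topologicalClosure_eq_top_iff, Submodule.eq_bot_iff]
    intro f hf
    refine hι (funext fun w => ext_inner_left ℂ fun v => ?_)
    have h0 := (Submodule.mem_orthogonal _ f).1 hf (k w v) ⟨Finsupp.single w v, by
      rw [Finsupp.lsum_single, kernelSection_apply]⟩
    simpa [hk] using h0
  exact Submodule.dense_iff_topologicalClosure_eq_top.2 h

/-- A bound between finite sums over `Fin N` passes to finitely supported families. -/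
theorem norm_lsum_le_of_fin {φ : D → V →ₗ[ℂ] E} {ψ : D → V →ₗ[ℂ] F} {c : ℝ}
    (h : ∀ (N : ℕ) (z : Fin N → D) (v : Fin N → V),
      ‖∑ i, ψ (z i) (v i)‖ ≤ c * ‖∑ i, φ (z i) (v i)‖) (e : D →₀ V) :
    ‖Finsupp.lsum ℂ ψ e‖ ≤ c * ‖Finsupp.lsum ℂ φ e‖ := by
  have h1 := h _ (fun i => (e.support.equivFin.symm i : D)) fun i => e (e.support.equivFin.symm i)
  rw [Equiv.sum_comp e.support.equivFin.symm fun i : e.support => ψ i (e i),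
    Equiv.sum_comp e.support.equivFin.symm fun i : e.support => φ i (e i),
    Finset.sum_coe_sort e.support fun i => ψ i (e i),
    Finset.sum_coe_sort e.support fun i => φ i (e i)] at h1
  exact h1

/-- The sum of all entries of a Gram matrix is a squared norm. -/
theorem sum_sum_inner_eq_norm_sq {κ : Type*} [Fintype κ] (x : κ → E) :
    ∑ j, ∑ k, ⟪x j, x k⟫_ℂ = (‖∑ k, x k‖ : ℂ) ^ 2 := by
  have h := inner_self_eq_norm_sq_to_K (𝕜 := ℂ) (∑ k, x k)
  simp only [sum_inner, inner_sum] at h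
  rw [Finset.sum_comm]
  exact h

/-- The quadratic form of the difference of two Gram kernels is a difference of squared norms. -/
theorem sum_sum_inner_sub_inner {κ : Type*} [Fintype κ] (c : ℝ) (x : κ → E) (y : κ → F) :
    ∑ j, ∑ k, ((c : ℂ) ^ 2 * ⟪x j, x k⟫_ℂ - ⟪y j, y k⟫_ℂ)
      = (((c * ‖∑ k, x k‖) ^ 2 - ‖∑ k, y k‖ ^ 2 : ℝ) : ℂ) := by
  simp_rw [Finset.sum_sub_distrib, ← Finset.mul_sum]
  rw [sum_sum_inner_eq_norm_sq, sum_sum_inner_eq_norm_sq]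
  push_cast
  ring

end Kernel

/-- Let `H` be a Hilbert space of `V`-valued functions on `D` with reproducing
kernel `K`, and let `T` be a linear map from `H` into the functions `D → V₁` whose point
evaluations `A z : H → V₁` are all bounded.  Let `H₁` be a Hilbert space of `V₁`-valued functions
on `D` with reproducing kernel `K₁`, and `c > 0`.  Then `T` maps `H` into `H₁` with operator norm
at most `c` if and only if the kernel `(z,w) ↦ c² K₁(z,w) − A z ∘ (A w)⋆` is positive
semidefinite. -/
theorem stmt_1
    {D : Type*} [Nonempty D]
    {V : Type*} [NormedAddCommGroup V] [InnerProductSpace ℂ V] [FiniteDimensional ℂ V]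
    {V₁ : Type*} [NormedAddCommGroup V₁] [InnerProductSpace ℂ V₁] [FiniteDimensional ℂ V₁]
    {H : Type*} [NormedAddCommGroup H] [InnerProductSpace ℂ H] [CompleteSpace H]
    {H₁ : Type*} [NormedAddCommGroup H₁] [InnerProductSpace ℂ H₁] [CompleteSpace H₁]
    (ι : H →ₗ[ℂ] (D → V)) (hι : Function.Injective ι)
    (ι₁ : H₁ →ₗ[ℂ] (D → V₁)) (hι₁ : Function.Injective ι₁)
    -- reproducing kernel data for `H`
    (K : D → D → (V →L[ℂ] V)) (kfun : D → V → H)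
    (hKrep : ∀ (w : D) (v : V), ι (kfun w v) = fun z => K z w v)
    (hKprop : ∀ (w : D) (v : V) (f : H), ⟪kfun w v, f⟫_ℂ = ⟪v, ι f w⟫_ℂ)
    -- reproducing kernel data for `H₁`
    (K₁ : D → D → (V₁ →L[ℂ] V₁)) (k₁fun : D → V₁ → H₁)
    (hK₁rep : ∀ (w : D) (v : V₁), ι₁ (k₁fun w v) = fun z => K₁ z w v)
    (hK₁prop : ∀ (w : D) (v : V₁) (f : H₁), ⟪k₁fun w v, f⟫_ℂ = ⟪v, ι₁ f w⟫_ℂ)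
    -- `T` and its bounded point evaluations
    (T : H →ₗ[ℂ] (D → V₁)) (A : D → (H →L[ℂ] V₁))
    (hA : ∀ (z : D) (f : H), A z f = T f z)
    (c : ℝ) (hc : 0 < c) :
    -- `T` maps `H` into `H₁` and is bounded with norm at most `c` ...
    (∃ S : H →L[ℂ] H₁, ‖S‖ ≤ c ∧ ∀ f : H, ι₁ (S f) = T f) ↔
    -- ... iff `c² K₁ − A_z ∘ A_w⋆ ⪰ 0`
    (∀ (N : ℕ) (z : Fin N → D) (v : Fin N → V₁),
      0 ≤ ∑ j, ∑ k, ⟪v j,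
        (((c : ℂ) ^ 2) • K₁ (z j) (z k)
          - (A (z j)).comp (ContinuousLinearMap.adjoint (A (z k)))) (v k)⟫_ℂ) := by
  have key (N : ℕ) (z : Fin N → D) (v : Fin N → V₁) :
      (0 ≤ ∑ j, ∑ k, ⟪v j, (((c : ℂ) ^ 2) • K₁ (z j) (z k)
          - (A (z j)).comp (ContinuousLinearMap.adjoint (A (z k)))) (v k)⟫_ℂ) ↔
      ‖∑ k, ContinuousLinearMap.adjoint (A (z k)) (v k)‖ ≤ c * ‖∑ k, k₁fun (z k) (v k)‖ := by
    rw [← sq_le_sq₀ (norm_nonneg _) (by positivity), ← sub_nonneg (b := ‖_‖ ^ 2), ← Complex.zero_le_real,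
      ← sum_sum_inner_sub_inner]
    simp [hK₁prop, hK₁rep,
      ContinuousLinearMap.adjoint_inner_left]
  simp_rw [key]
  constructor
  · rintro ⟨S, hS, hST⟩ N z v
    have hadj (w : D) (u : V₁) :
        ContinuousLinearMap.adjoint (A w) u = ContinuousLinearMap.adjoint S (k₁fun w u) :=
      ext_inner_right ℂ fun f => by
        simp [ContinuousLinearMap.adjoint_inner_left, hK₁prop, hST, hA]
    simp_rw [hadj, ← map_sum]
    refine ContinuousLinearMap.le_of_opNorm_le _ ?_ _
    simpa using hS
  · intro h
    set P := Finsupp.lsum ℂ (kernelSection ι₁ k₁fun hK₁prop)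
    set Q := Finsupp.lsum ℂ fun w => (ContinuousLinearMap.adjoint (A w)).toLinearMap
    have hP : DenseRange P := denseRange_lsum_kernelSection ι₁ hι₁ k₁fun hK₁prop
    have hQP : ∀ e, ‖Q e‖ ≤ c * ‖P e‖ := norm_lsum_le_of_fin h
    refine ⟨ContinuousLinearMap.adjoint (Q.extendOfNorm P), ?_, fun f => ?_⟩
    · simpa using LinearMap.opNorm_extendOfNorm_le hP hc.le hQP
    · refine funext fun w => ext_inner_left ℂ fun v => ?_
      have hk : Q.extendOfNorm P (k₁fun w v) = ContinuousLinearMap.adjoint (A w) v := by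
        have h1 := LinearMap.extendOfNorm_eq hP ⟨c, hQP⟩ (Finsupp.single w v)
        rwa [Finsupp.lsum_single, Finsupp.lsum_single, kernelSection_apply] at h1
      rw [← hK₁prop, ContinuousLinearMap.adjoint_inner_right, hk,
        ContinuousLinearMap.adjoint_inner_left, hA]
end

section
/- Let D ⊆ ℂⁿ be a nonempty open set, V a finite-dimensional complex inner product space, and H a Hilbert space of V-valued functions on D all of whose elements are holomorphic on D. Assume that for every w ∈ D the evaluation map ev_w : H → V, f ↦ f(w), is a bounded linear map. Then for every z ∈ D and every k ∈ ℕ, the map sending f ∈ H to the k-th iterated (complex) Fréchet derivative of f at z is a bounded linear map from H into the space of continuous k-multilinear maps (ℂⁿ)^k → V. Consequently, any linear differential operator of finite order with arbitrary Hom(V,V₁)-valued coefficient functions satisfies the hypothesis that all its point evaluations f ↦ (Tf)(z) are bounded on H. -/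
open scoped InnerProductSpace

open Set Metric MeasureTheory Filter Topology

/-- Cauchy's estimate and differentiation under the Cauchy integral: each directional derivative
of a holomorphic map is holomorphic. -/
theorem differentiableAt_fderiv_apply_of_differentiableOn
    {E F : Type*} [NormedAddCommGroup E] [NormedSpace ℂ E]
    [NormedAddCommGroup F] [NormedSpace ℂ F] [FiniteDimensional ℂ E] [FiniteDimensional ℂ F]
    {f : E → F} {U : Set E} (hf : DifferentiableOn ℂ f U) (hU : IsOpen U)
    {x₀ : E} (hx₀ : x₀ ∈ U) (v : E) :
    DifferentiableAt ℂ (fun x ↦ fderiv ℂ f x v) x₀ := by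
  have : CompleteSpace F := FiniteDimensional.complete ℂ F
  obtain ⟨ε, hε, hεU, M, hM⟩ :
      ∃ ε > 0, ball x₀ ε ⊆ U ∧ ∃ M, ∀ y ∈ ball x₀ ε, ‖f y‖ ≤ M := by
    have hc : ContinuousAt f x₀ := (hf.differentiableAt (hU.mem_nhds hx₀)).continuousAt
    have h1 : ∀ᶠ y in 𝓝 x₀, ‖f y‖ < ‖f x₀‖ + 1 :=
      hc.norm.eventually_lt_const (lt_add_one _)
    obtain ⟨ε, hε, h⟩ := Metric.eventually_nhds_iff_ball.1 (h1.and (hU.mem_nhds hx₀))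
    exact ⟨ε, hε, fun y hy ↦ (h y hy).2, _, fun y hy ↦ (h y hy).1.le⟩
  have hdiff : ∀ y ∈ ball x₀ ε, DifferentiableAt ℂ f y := fun y hy ↦
    hf.differentiableAt (hU.mem_nhds (hεU hy))
  have hbound : ∀ y ∈ ball x₀ (2 * ε / 3), ‖fderiv ℂ f y‖ ≤ 2 * M / (ε / 3) := by
    intro y hy
    have hsub : ball y (ε / 3) ⊆ ball x₀ ε :=
      ball_subset_ball' (by rw [mem_ball] at hy; linarith)
    refine Complex.norm_fderiv_le_div_of_mapsTo_ball (hf.mono (hsub.trans hεU)) ?_ (by positivity)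
    intro w hw
    rw [mem_closedBall, dist_eq_norm]
    have := hM w (hsub hw)
    have := hM y (hsub (mem_ball_self (by positivity)))
    linarith [norm_sub_le (f w) (f y)]
  obtain ⟨r, hr, hrv⟩ : ∃ r > 0, r * ‖v‖ < ε / 3 := by
    refine ⟨ε / (3 * (‖v‖ + 1)), by positivity, ?_⟩
    rw [div_mul_eq_mul_div, div_lt_div_iff₀ (by positivity) (by positivity)]
    nlinarith [norm_nonneg v]
  have hmem : ∀ x ∈ ball x₀ (ε / 3), ∀ ζ ∈ closedBall (0 : ℂ) r,
      x + ζ • v ∈ ball x₀ (2 * ε / 3) := by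
    intro x hx ζ hζ
    rw [mem_ball, dist_eq_norm] at hx ⊢
    have hζ' : ‖ζ • v‖ ≤ r * ‖v‖ := by
      rw [norm_smul]
      gcongr
      simpa using hζ
    calc ‖x + ζ • v - x₀‖ = ‖(x - x₀) + ζ • v‖ := by congr 1; abel
      _ ≤ ‖x - x₀‖ + ‖ζ • v‖ := norm_add_le _ _
      _ < 2 * ε / 3 := by linarith
  have hsub : ball x₀ (2 * ε / 3) ⊆ ball x₀ ε := ball_subset_ball (by linarith)
  have hγ : ∀ θ : ℝ, circleMap 0 r θ ∈ closedBall (0 : ℂ) r :=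
    fun θ ↦ circleMap_mem_closedBall 0 hr.le θ
  set κ : ℝ → ℂ := fun θ ↦ deriv (circleMap 0 r) θ * (1 / (circleMap 0 r θ - 0) ^ 2) with hκ_def
  have hκ : Continuous κ := by
    have h0 : ∀ θ, (circleMap 0 r θ - 0) ^ 2 ≠ 0 := fun θ ↦ by
      simpa using hr.ne'
    simp only [hκ_def, deriv_circleMap]
    fun_prop (disch := exact h0 _)
  -- Cauchy's formula for the derivative along the complex line through `x` in direction `v`
  have hcauchy : ∀ x ∈ ball x₀ (ε / 3), fderiv ℂ f x v = (2 * Real.pi * Complex.I : ℂ)⁻¹ •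
      ∫ θ in Ioc 0 (2 * Real.pi), κ θ • f (x + circleMap 0 r θ • v) := by
    intro x hx
    have hline : ∀ ζ : ℂ, HasDerivAt (fun ζ : ℂ ↦ x + ζ • v) v ζ := fun ζ ↦ by
      simpa using ((hasDerivAt_id ζ).smul_const v).const_add x
    have hd : DifferentiableOn ℂ (fun ζ : ℂ ↦ f (x + ζ • v)) (closedBall 0 r) := fun ζ hζ ↦
      ((hdiff _ (hsub (hmem x hx ζ hζ))).comp ζ
        (hline ζ).differentiableAt).differentiableWithinAt
    have hderiv : deriv (fun ζ : ℂ ↦ f (x + ζ • v)) 0 = fderiv ℂ f x v := by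
      have hx' : DifferentiableAt ℂ f (x + (0 : ℂ) • v) :=
        hdiff _ (hsub (hmem x hx 0 (mem_closedBall_self hr.le)))
      have := (hx'.hasFDerivAt.comp_hasDerivAt (0 : ℂ) (hline 0)).deriv
      simpa [Function.comp_def] using this
    have hint := hd.deriv_eq_smul_circleIntegral hr
    rw [hderiv, circleIntegral, intervalIntegral.integral_of_le (by positivity)] at hint
    simp only [smul_smul] at hint
    rw [hint, inv_smul_smul₀ Complex.two_pi_I_ne_zero]
  have hball : ball x₀ (ε / 3) ∈ 𝓝 x₀ := ball_mem_nhds _ (by positivity)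
  have hcont : ∀ x ∈ ball x₀ (ε / 3),
      Continuous fun θ ↦ κ θ • f (x + circleMap 0 r θ • v) := by
    intro x hx
    refine hκ.smul (continuous_iff_continuousAt.2 fun θ ↦ ?_)
    refine ContinuousAt.comp (f := fun θ ↦ x + circleMap 0 r θ • v)
      (hdiff _ (hsub (hmem x hx _ (hγ θ)))).continuousAt ?_
    fun_prop
  have hG := hasFDerivAt_integral_of_dominated_of_fderiv_le (𝕜 := ℂ)
    (μ := volume.restrict (Ioc 0 (2 * Real.pi)))
    (F := fun x θ ↦ κ θ • f (x + circleMap 0 r θ • v))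
    (F' := fun x θ ↦ κ θ • fderiv ℂ f (x + circleMap 0 r θ • v))
    (bound := fun θ ↦ ‖κ θ‖ * (2 * M / (ε / 3))) hball
    (eventually_of_mem hball fun x hx ↦ (hcont x hx).aestronglyMeasurable)
    (((hcont x₀ (mem_ball_self (by positivity))).continuousOn.integrableOn_Icc).mono_set
      Ioc_subset_Icc_self)
    (by
      borelize E F
      have : ProperSpace (E →L[ℂ] F) := FiniteDimensional.proper ℂ _
      borelize (E →L[ℂ] F)
      have : Measurable fun θ ↦ fderiv ℂ f (x₀ + circleMap 0 r θ • v) :=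
        (measurable_fderiv ℂ f).comp (by fun_prop : Continuous _).measurable
      exact (hκ.measurable.smul this).aestronglyMeasurable)
    (ae_of_all _ fun θ x hx ↦ by
      rw [norm_smul]
      gcongr
      exact hbound _ (hmem x hx _ (hγ θ)))
    ((by fun_prop : Continuous fun θ ↦ ‖κ θ‖ * (2 * M / (ε / 3))).continuousOn.integrableOn_Icc
      |>.mono_set Ioc_subset_Icc_self)
    (ae_of_all _ fun θ x hx ↦
      ((hasFDerivAt_comp_add_right (circleMap 0 r θ • v)).2
        (hdiff _ (hsub (hmem x hx _ (hγ θ)))).hasFDerivAt).const_smul (κ θ))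
  refine (hG.differentiableAt.const_smul (2 * Real.pi * Complex.I : ℂ)⁻¹).congr_of_eventuallyEq ?_
  exact eventually_of_mem hball hcauchy

/-- The Fréchet derivative of a holomorphic map is holomorphic. -/
theorem DifferentiableOn.fderivWithin_of_finiteDimensional
    {E F : Type*} [NormedAddCommGroup E] [NormedSpace ℂ E]
    [NormedAddCommGroup F] [NormedSpace ℂ F] [FiniteDimensional ℂ E] [FiniteDimensional ℂ F]
    {f : E → F} {U : Set E} (hf : DifferentiableOn ℂ f U) (hU : IsOpen U) :
    DifferentiableOn ℂ (fderivWithin ℂ f U) U := by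
  intro x hx
  let d := Module.finrank ℂ E
  have hd : d = Module.finrank ℂ (Fin d → ℂ) := (Module.finrank_fin_fun ℂ).symm
  let e₁ := ContinuousLinearEquiv.ofFinrankEq hd
  let e₂ := (e₁.arrowCongr (1 : F ≃L[ℂ] F)).trans (ContinuousLinearEquiv.piRing (Fin d))
  have h : DifferentiableAt ℂ (fderiv ℂ f) x := by
    rw [← e₂.comp_differentiableAt_iff, differentiableAt_pi]
    intro i
    exact differentiableAt_fderiv_apply_of_differentiableOn hf hU hx (e₁.symm (Pi.single i 1))
  exact h.differentiableWithinAt.congr (fun y hy ↦ fderivWithin_of_isOpen hU hy)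
    (fderivWithin_of_isOpen hU hx)

/-- If all point evaluations of a family of holomorphic maps parametrized by a Banach space are
bounded linear, then so are the evaluations of the Fréchet derivative. -/
theorem exists_clm_eq_fderivWithin
    {E F H : Type*} [NormedAddCommGroup E] [NormedSpace ℂ E]
    [NormedAddCommGroup F] [NormedSpace ℂ F] [FiniteDimensional ℂ E]
    [NormedAddCommGroup H] [NormedSpace ℂ H] [CompleteSpace H]
    {D : Set E} (hD : IsOpen D) {g : H → E → F} (hg : ∀ f, DifferentiableOn ℂ (g f) D)
    (hev : ∀ z ∈ D, ∃ L : H →L[ℂ] F, ∀ f, L f = g f z) {z : E} (hz : z ∈ D) :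
    ∃ L : H →L[ℂ] (E →L[ℂ] F), ∀ f, L f = fderivWithin ℂ (g f) D z := by
  choose! L hL using hev
  have key : ∀ v, ∃ A : H →L[ℂ] F, ∀ f, A f = fderivWithin ℂ (g f) D z v := by
    intro v
    have hlim : Tendsto (fun (t : ℂ) (f : H) ↦ (t⁻¹ • (L (z + t • v) - L z)) f) (𝓝[≠] 0)
        (𝓝 fun f ↦ fderivWithin ℂ (g f) D z v) := by
      rw [tendsto_pi_nhds]
      intro f
      have hfd : HasFDerivAt (g f) (fderivWithin ℂ (g f) D z) z :=
        ((hg f z hz).hasFDerivWithinAt).hasFDerivAt (hD.mem_nhds hz)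
      have hslope := (hfd.hasLineDerivAt v).tendsto_slope_zero
      refine hslope.congr' ?_
      have hnear : ∀ᶠ t : ℂ in 𝓝[≠] 0, z + t • v ∈ D := by
        refine nhdsWithin_le_nhds ?_
        have hc : ContinuousAt (fun t : ℂ ↦ z + t • v) 0 := by fun_prop
        exact hc.preimage_mem_nhds (by simpa using hD.mem_nhds hz)
      filter_upwards [hnear] with t ht
      simp [hL _ ht, hL _ hz]
    exact ⟨continuousLinearMapOfTendsto _ hlim, fun f ↦ rfl⟩
  choose A hA using key
  refine ⟨⟨{ toFun := fun f ↦ fderivWithin ℂ (g f) D z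
             map_add' := fun f₁ f₂ ↦ ?_
             map_smul' := fun c f ↦ ?_ }, ?_⟩, fun f ↦ rfl⟩
  · ext v
    simp [← hA]
  · ext v
    simp [← hA]
  · refine continuous_clm_apply.2 fun v ↦ ?_
    simpa [← hA] using (A v).continuous

/-- If all point evaluations of a family of holomorphic maps parametrized by a Banach space are
bounded linear, then so are the evaluations of all iterated Fréchet derivatives. -/
theorem exists_clm_eq_iteratedFDerivWithin.{u, v, w}
    {E : Type u} {H : Type w} [NormedAddCommGroup E] [NormedSpace ℂ E] [FiniteDimensional ℂ E]
    [NormedAddCommGroup H] [NormedSpace ℂ H] [CompleteSpace H]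
    {D : Set E} (hD : IsOpen D) {z : E} (hz : z ∈ D) (k : ℕ)
    {F : Type (max u v)} [NormedAddCommGroup F] [NormedSpace ℂ F] [FiniteDimensional ℂ F]
    {g : H → E → F} (hg : ∀ f, DifferentiableOn ℂ (g f) D)
    (hev : ∀ z ∈ D, ∃ L : H →L[ℂ] F, ∀ f, L f = g f z) :
    ∃ L : H →L[ℂ] ContinuousMultilinearMap ℂ (fun _ : Fin k ↦ E) F,
      ∀ f, L f = iteratedFDerivWithin ℂ k (g f) D z := by
  induction k generalizing F with
  | zero =>
    obtain ⟨L, hL⟩ := hev z hz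
    refine ⟨(continuousMultilinearCurryFin0 ℂ E F).symm.toContinuousLinearEquiv.toContinuousLinearMap
      ∘L L, fun f ↦ ?_⟩
    simp [iteratedFDerivWithin_zero_eq_comp, hL]
  | succ k ih =>
    obtain ⟨L, hL⟩ := ih (fun f ↦ (hg f).fderivWithin_of_finiteDimensional hD)
      fun z hz ↦ exists_clm_eq_fderivWithin hD hg hev hz
    refine ⟨(continuousMultilinearCurryRightEquiv' ℂ k E
      F).symm.toContinuousLinearEquiv.toContinuousLinearMap ∘L L, fun f ↦ ?_⟩
    rw [iteratedFDerivWithin_succ_eq_comp_right hD.uniqueDiffOn hz, ContinuousLinearMap.comp_apply,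
      hL]
    rfl

/-- Let `D ⊆ ℂⁿ` be a nonempty open set, `V` a finite-dimensional complex inner
product space, and `H` a Hilbert space of `V`-valued functions, all holomorphic on `D` (functions
are realized as total functions on `ℂⁿ`, with `H` separated by its values on `D`).  If all point
evaluations at points of `D` are bounded, then for every `z ∈ D` and `k ∈ ℕ` the map sending
`f` to its `k`-th iterated complex Fréchet derivative at `z` is a bounded linear map from `H`
into the continuous `k`-multilinear maps `(ℂⁿ)^k → V`.  Consequently, every finite-order linear
differential operator with operator-valued coefficients has bounded point evaluations on `H`. -/
theorem stmt_2 {n : ℕ}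
    (D : Set (Fin n → ℂ)) (hD : IsOpen D) (hDne : D.Nonempty)
    {V : Type*} [NormedAddCommGroup V] [InnerProductSpace ℂ V] [FiniteDimensional ℂ V]
    {H : Type*} [NormedAddCommGroup H] [InnerProductSpace ℂ H] [CompleteSpace H]
    (ι : H →ₗ[ℂ] ((Fin n → ℂ) → V))
    -- `H` is a space of functions on `D`: elements are determined by their values on `D`
    (hsep : ∀ f g : H, (∀ z ∈ D, ι f z = ι g z) → f = g)
    -- all elements of `H` are holomorphic on `D`
    (hhol : ∀ f : H, DifferentiableOn ℂ (ι f) D)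
    -- the point evaluations at points of `D` are bounded
    (ev : (Fin n → ℂ) → (H →L[ℂ] V))
    (hev : ∀ z ∈ D, ∀ f : H, ev z f = ι f z) :
    -- the iterated-derivative evaluations are bounded linear maps on `H`
    (∀ z ∈ D, ∀ k : ℕ,
      ∃ Dk : H →L[ℂ] ContinuousMultilinearMap ℂ (fun _ : Fin k => (Fin n → ℂ)) V,
        ∀ f : H, Dk f = iteratedFDerivWithin ℂ k (ι f) D z) ∧
    -- consequently, any finite-order linear differential operator with arbitrary
    -- operator-valued coefficients has bounded point evaluations on `H`
    (∀ (V₁ : Type) [NormedAddCommGroup V₁] [NormedSpace ℂ V₁], ∀ (N : ℕ)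
      (a : (k : ℕ) → (Fin n → ℂ) →
        (ContinuousMultilinearMap ℂ (fun _ : Fin k => (Fin n → ℂ)) V →L[ℂ] V₁)),
      ∀ z ∈ D, ∃ Tz : H →L[ℂ] V₁,
        ∀ f : H, Tz f = ∑ k ∈ Finset.range (N + 1),
          a k z (iteratedFDerivWithin ℂ k (ι f) D z)) := by
  have main : ∀ z ∈ D, ∀ k : ℕ,
      ∃ Dk : H →L[ℂ] ContinuousMultilinearMap ℂ (fun _ : Fin k => (Fin n → ℂ)) V,
        ∀ f : H, Dk f = iteratedFDerivWithin ℂ k (ι f) D z := fun z hz k ↦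
    exists_clm_eq_iteratedFDerivWithin hD hz k hhol fun w hw ↦ ⟨ev w, hev w hw⟩
  refine ⟨main, fun V₁ _ _ N a z hz ↦ ?_⟩
  choose Dk hDk using main z hz
  exact ⟨∑ k ∈ Finset.range (N + 1), a k z ∘L Dk k, fun f ↦ by simp [hDk]⟩
end

section
/- Let G be a group acting on a set D, let m : G × D → GL(V) be a multiplier, i.e. m(g g', z) = m(g, g'·z) m(g', z) for all g, g' ∈ G and z ∈ D, and for g ∈ G define the linear operator U_g on functions D → V by (U_g f)(z) = m(g⁻¹, z)⁻¹ f(g⁻¹·z). Let H be a Hilbert space of V-valued functions on D with reproducing kernel K. Then every U_g maps H into H and acts as a unitary operator on H if and only if K is quasi-invariant, i.e. K(g·z, g·w) = m(g,z) ∘ K(z,w) ∘ m(g,w)^* for all g ∈ G and z, w ∈ D (where m(g,w)^* denotes the Hermitian adjoint on V). -/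
open scoped InnerProductSpace

section LinearIsometryOfGram

variable {I 𝕜 E F : Type*} [RCLike 𝕜] [NormedAddCommGroup E] [InnerProductSpace 𝕜 E]
  [NormedAddCommGroup F] [InnerProductSpace 𝕜 F]

/-- Linear combinations of two families with the same Gram matrix have the same norm. -/
theorem norm_linearCombination_eq_of_inner_eq {a : I → E} {b : I → F}
    (hab : ∀ i j, ⟪a i, a j⟫_𝕜 = ⟪b i, b j⟫_𝕜) (x : I →₀ 𝕜) :
    ‖Finsupp.linearCombination 𝕜 b x‖ = ‖Finsupp.linearCombination 𝕜 a x‖ := by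
  rw [@norm_eq_sqrt_re_inner 𝕜, @norm_eq_sqrt_re_inner 𝕜]
  simp only [Finsupp.linearCombination_apply, Finsupp.sum, sum_inner, inner_sum, inner_smul_left,
    inner_smul_right, hab]

/-- If a family `a` spans a dense subspace and `b` has the same Gram matrix, then some linear
isometry maps `a` to `b`. -/
theorem exists_linearIsometry_apply_eq_of_inner_eq [CompleteSpace F] {a : I → E} {b : I → F}
    (ha : Dense (Submodule.span 𝕜 (Set.range a) : Set E))
    (hab : ∀ i j, ⟪a i, a j⟫_𝕜 = ⟪b i, b j⟫_𝕜) :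
    ∃ T : E →ₗᵢ[𝕜] F, ∀ i, T (a i) = b i := by
  set A := Finsupp.linearCombination 𝕜 a
  set B := Finsupp.linearCombination 𝕜 b
  have hnorm : ∀ x, ‖B x‖ = ‖A x‖ := norm_linearCombination_eq_of_inner_eq hab
  have hdense : DenseRange A := by
    rw [← Finsupp.range_linearCombination] at ha
    simpa only [DenseRange, LinearMap.coe_range] using ha
  have hT : ∀ x, B.extendOfNorm A (A x) = B x :=
    LinearMap.extendOfNorm_eq hdense ⟨1, fun x => by rw [one_mul, hnorm]⟩
  refine ⟨⟨(B.extendOfNorm A).toLinearMap, fun y => ?_⟩, fun i => ?_⟩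
  · refine hdense.induction_on (p := fun y => ‖B.extendOfNorm A y‖ = ‖y‖) y
      (isClosed_eq (by fun_prop) (by fun_prop)) fun x => ?_
    rw [hT, hnorm]
  · simpa [A, B] using hT (Finsupp.single i 1)

end LinearIsometryOfGram

section Multiplier

variable {D G V : Type*} [Group G] [MulAction G D] [NormedAddCommGroup V] [InnerProductSpace ℂ V]
  {m : G → D → (V ≃L[ℂ] V)}

theorem multiplier_one_apply
    (hm : ∀ (g g' : G) (z : D), m (g * g') z = (m g' z).trans (m g (g' • z))) (z : D) (v : V) :
    m 1 z v = v := by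
  have h := congrArg (fun e => e v) (hm 1 1 z)
  simp only [mul_one, one_smul, ContinuousLinearEquiv.trans_apply] at h
  exact ((m 1 z).injective h).symm

theorem multiplier_inv_symm_apply
    (hm : ∀ (g g' : G) (z : D), m (g * g') z = (m g' z).trans (m g (g' • z)))
    (g : G) (z : D) (v : V) : (m g⁻¹ (g • z)).symm v = m g z v := by
  rw [ContinuousLinearEquiv.symm_apply_eq, ← ContinuousLinearEquiv.trans_apply, ← hm,
    inv_mul_cancel, multiplier_one_apply hm]

/-- The formula `(U_g f)(z) = m(g⁻¹,z)⁻¹ f(g⁻¹·z)`, written at the point `g·z`. -/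
theorem forall_eq_multiplier_inv_symm_iff
    (hm : ∀ (g g' : G) (z : D), m (g * g') z = (m g' z).trans (m g (g' • z)))
    (g : G) (f f' : D → V) :
    (∀ z, f' z = (m g⁻¹ z).symm (f (g⁻¹ • z))) ↔ ∀ z, f' (g • z) = m g z (f z) := by
  rw [(MulAction.surjective g).forall]
  simp only [inv_smul_smul, multiplier_inv_symm_apply hm]

end Multiplier

section ReproducingKernel

variable {D V H : Type*} [NormedAddCommGroup V] [InnerProductSpace ℂ V] [FiniteDimensional ℂ V]
  [NormedAddCommGroup H] [InnerProductSpace ℂ H]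
  {ι : H →ₗ[ℂ] (D → V)} {kfun : D → V → H}

/-- Kernel functions, reparametrized by automorphisms of `V`, span a dense subspace. -/
theorem dense_span_kernel_adjoint [CompleteSpace H] (hι : Function.Injective ι)
    (hKprop : ∀ (w : D) (v : V) (f : H), ⟪kfun w v, f⟫_ℂ = ⟪v, ι f w⟫_ℂ) (e : D → (V ≃L[ℂ] V)) :
    Dense (Submodule.span ℂ (Set.range fun p : D × V =>
      kfun p.1 (ContinuousLinearMap.adjoint (e p.1 : V →L[ℂ] V) p.2)) : Set H) := by
  rw [Submodule.dense_iff_topologicalClosure_eq_top, Submodule.topologicalClosure_eq_top_iff,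
    Submodule.eq_bot_iff]
  intro f hf
  refine hι (funext fun w => ?_)
  rw [map_zero, Pi.zero_apply, ← (e w).map_eq_zero_iff, ← inner_self_eq_zero (𝕜 := ℂ)]
  have h := (Submodule.mem_orthogonal _ f).1 hf _
    (Submodule.subset_span ⟨(w, e w (ι f w)), rfl⟩)
  rwa [hKprop, ContinuousLinearMap.adjoint_inner_left] at h

end ReproducingKernel

/-- Let a group `G` act on `D`, let `m : G × D → GL(V)` be a multiplier
(`m(gg',z) = m(g,g'·z) m(g',z)`), and for `g ∈ G` define `(U_g f)(z) = m(g⁻¹,z)⁻¹ f(g⁻¹·z)`.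
Let `H` be a Hilbert space of `V`-valued functions on `D` with reproducing kernel `K`.
Then every `U_g` maps `H` into `H` and acts as a unitary operator on `H` if and only if `K`
is quasi-invariant: `K(g·z, g·w) = m(g,z) ∘ K(z,w) ∘ m(g,w)⋆` for all `g, z, w`. -/
theorem stmt_3
    {D : Type*} [Nonempty D] {G : Type*} [Group G] [MulAction G D]
    {V : Type*} [NormedAddCommGroup V] [InnerProductSpace ℂ V] [FiniteDimensional ℂ V]
    {H : Type*} [NormedAddCommGroup H] [InnerProductSpace ℂ H] [CompleteSpace H]
    -- the multiplier, with values in `GL(V)`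
    (m : G → D → (V ≃L[ℂ] V))
    (hm : ∀ (g g' : G) (z : D), m (g * g') z = (m g' z).trans (m g (g' • z)))
    (ι : H →ₗ[ℂ] (D → V)) (hι : Function.Injective ι)
    -- reproducing kernel data for `H`
    (K : D → D → (V →L[ℂ] V)) (kfun : D → V → H)
    (hKrep : ∀ (w : D) (v : V), ι (kfun w v) = fun z => K z w v)
    (hKprop : ∀ (w : D) (v : V) (f : H), ⟪kfun w v, f⟫_ℂ = ⟪v, ι f w⟫_ℂ) :
    -- every `U_g` preserves `H` and is unitary on it ...
    (∀ g : G, ∃ U : H ≃ₗᵢ[ℂ] H, ∀ (f : H) (z : D),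
        ι (U f) z = (m g⁻¹ z).symm (ι f (g⁻¹ • z))) ↔
    -- ... iff `K` is quasi-invariant
    (∀ (g : G) (z w : D),
        K (g • z) (g • w)
          = (((m g z : V →L[ℂ] V)).comp (K z w)).comp
              (ContinuousLinearMap.adjoint ((m g w : V →L[ℂ] V)))) := by
  simp only [fun (g : G) (U : H ≃ₗᵢ[ℂ] H) (f : H) =>
    forall_eq_multiplier_inv_symm_iff hm g (ι f) (ι (U f))]
  constructor
  · intro hU g z w
    obtain ⟨U, hU⟩ := hU g
    ext v
    have hk : U (kfun w (ContinuousLinearMap.adjoint (m g w : V →L[ℂ] V) v)) =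
        kfun (g • w) v := by
      refine ext_inner_right ℂ fun f => ?_
      obtain ⟨f, rfl⟩ := U.surjective f
      rw [U.inner_map_map, hKprop, hKprop, hU, ContinuousLinearMap.adjoint_inner_left]
      rfl
    have h := congrFun (congrArg ι hk) (g • z)
    rw [hU, hKrep, hKrep] at h
    exact h.symm
  · intro hK
    have key : ∀ g : G, ∃ T : H →ₗᵢ[ℂ] H, ∀ (f : H) (z : D), ι (T f) (g • z) = m g z (ι f z) := by
      intro g
      obtain ⟨T, hT⟩ := exists_linearIsometry_apply_eq_of_inner_eq
        (b := fun p : D × V => kfun (g • p.1) p.2) (dense_span_kernel_adjoint hι hKprop (m g))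
        (by
          rintro ⟨z, v⟩ ⟨w, u⟩
          rw [hKprop, hKprop, hKrep, hKrep, ContinuousLinearMap.adjoint_inner_left]
          simp only [hK, ContinuousLinearMap.comp_apply])
      refine ⟨T, fun f z => ext_inner_left ℂ fun v => ?_⟩
      rw [← hKprop, ← hT (z, v), T.inner_map_map, hKprop, ContinuousLinearMap.adjoint_inner_left]
      rfl
    intro g
    obtain ⟨T, hT⟩ := key g
    obtain ⟨S, hS⟩ := key g⁻¹
    refine ⟨LinearIsometryEquiv.ofSurjective T fun f => ⟨S f, hι (funext fun z => ?_)⟩, hT⟩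
    obtain ⟨z, rfl⟩ := MulAction.surjective g z
    have h := hS f (g • z)
    rw [inv_smul_smul] at h
    rw [hT, h, ← multiplier_inv_symm_apply hm, ContinuousLinearEquiv.symm_apply_apply]
end

section
/- Let D be a nonempty set and V a finite-dimensional complex inner product space. If k : D × D → ℂ is a positive semidefinite scalar kernel (i.e. Σ_{j,l=1}^N k(z_j,z_l) c_l \overline{c_j} is real and nonnegative for all finite lists z_1,…,z_N ∈ D and c_1,…,c_N ∈ ℂ) and L : D × D → End(V) is a positive semidefinite End(V)-valued kernel, then the kernel (z,w) ↦ k(z,w) · L(z,w) is positive semidefinite. -/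
open scoped InnerProductSpace ComplexOrder ComplexConjugate

/-- A complex matrix whose quadratic form is real and nonnegative is Hermitian and hence
positive semidefinite. -/
theorem Matrix.posSemidef_of_forall_sum_nonneg {n : Type*} [Fintype n]
    {M : Matrix n n ℂ}
    (h : ∀ c : n → ℂ, 0 ≤ ∑ j, ∑ l, M j l * c l * conj (c j)) : M.PosSemidef := by
  classical
  rw [← Matrix.isPositive_toEuclideanLin_iff, LinearMap.isPositive_iff_complex]
  intro x
  have key : ⟪x, M.toEuclideanLin x⟫_ℂ = ∑ j, ∑ l, M j l * x l * conj (x j) := by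
    simp [PiLp.inner_apply, Matrix.mulVec, dotProduct, Finset.sum_mul]
  have hx : 0 ≤ ⟪M.toEuclideanLin x, x⟫_ℂ := by
    rw [← inner_conj_symm, key]
    exact star_nonneg_iff.mpr (h x.ofLp)
  obtain ⟨hre, him⟩ := Complex.nonneg_iff.mp hx
  exact ⟨Complex.ext rfl him, hre⟩

/-- If `k : D × D → ℂ` is a positive semidefinite scalar kernel and
`L : D × D → End(V)` is a positive semidefinite operator-valued kernel, then the kernel
`(z,w) ↦ k(z,w) • L(z,w)` is positive semidefinite. -/
theorem stmt_7
    {D : Type*} [Nonempty D]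
    {V : Type*} [NormedAddCommGroup V] [InnerProductSpace ℂ V] [FiniteDimensional ℂ V]
    (k : D → D → ℂ)
    (hk : ∀ (N : ℕ) (z : Fin N → D) (c : Fin N → ℂ),
      0 ≤ ∑ j, ∑ l, k (z j) (z l) * c l * conj (c j))
    (L : D → D → (V →L[ℂ] V))
    (hL : ∀ (N : ℕ) (z : Fin N → D) (v : Fin N → V),
      0 ≤ ∑ j, ∑ l, ⟪v j, L (z j) (z l) (v l)⟫_ℂ) :
    ∀ (N : ℕ) (z : Fin N → D) (v : Fin N → V),
      0 ≤ ∑ j, ∑ l, ⟪v j, k (z j) (z l) • L (z j) (z l) (v l)⟫_ℂ := by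
  intro N z v
  have hK : (Matrix.of fun j l => k (z j) (z l)).PosSemidef :=
    Matrix.posSemidef_of_forall_sum_nonneg (hk N z)
  have hM : (Matrix.of fun j l => ⟪v j, L (z j) (z l) (v l)⟫_ℂ).PosSemidef := by
    refine Matrix.posSemidef_of_forall_sum_nonneg fun c => ?_
    refine (hL N z fun j => c j • v j).trans_eq ?_
    refine Finset.sum_congr rfl fun j _ => Finset.sum_congr rfl fun l _ => ?_
    simp only [map_smul, inner_smul_left, inner_smul_right, Matrix.of_apply]
    ring
  simpa [Matrix.mulVec, dotProduct, inner_smul_right] using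
    (hK.hadamard hM).dotProduct_mulVec_nonneg 1
end

section
/- Let D ⊆ ℂⁿ be a nonempty subset, V a finite-dimensional complex inner product space, and H a Hilbert space of V-valued functions on D with reproducing kernel K. Assume that every V-valued polynomial function (restricted to D) belongs to H, that these polynomials are dense in H, and that for each 1 ≤ i ≤ n the multiplication operator M_i, (M_i f)(z) = z_i f(z), maps H into H and is bounded. Then for every w ∈ D the joint eigenspace {f ∈ H : M_i^* f = \overline{w_i} f for all 1 ≤ i ≤ n} of the adjoints M_1^*,…,M_n^* is exactly the set {K(·,w)v : v ∈ V}; in particular M_i^*(K(·,w)v) = \overline{w_i} K(·,w)v for all w ∈ D, v ∈ V, 1 ≤ i ≤ n. -/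
open scoped InnerProductSpace ComplexConjugate

/-- A `V`-valued polynomial function on `D ⊆ ℂⁿ`: a finite sum of functions
`z ↦ p(z) • v` with `p` a polynomial in `z₁, …, z_n` and `v ∈ V` (equivalently, a function
whose coordinates with respect to a basis of `V` are polynomials). -/
def IsPolyFun {n : ℕ} {D : Set (Fin n → ℂ)} {V : Type*} [AddCommMonoid V] [Module ℂ V]
    (F : D → V) : Prop :=
  ∃ (N : ℕ) (p : Fin N → MvPolynomial (Fin n) ℂ) (v : Fin N → V),
    ∀ z : D, F z = ∑ i, MvPolynomial.eval (z : Fin n → ℂ) (p i) • v i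

/-- If `f` is a joint eigenvector of the adjoints of the coordinate multiplication operators, then
pairing `f` with `p • v` evaluates `p` at the joint eigenvalue. -/
theorem inner_eq_eval_mul_of_adjoint_eigenvector {n : ℕ} {D : Set (Fin n → ℂ)}
    {V : Type*} [AddCommGroup V] [Module ℂ V]
    {H : Type*} [NormedAddCommGroup H] [InnerProductSpace ℂ H] [CompleteSpace H]
    (ι : H →ₗ[ℂ] (D → V)) (hι : Function.Injective ι)
    (hpoly : ∀ F : D → V, IsPolyFun F → ∃ f : H, ι f = F)
    (M : Fin n → (H →L[ℂ] H))
    (hM : ∀ (i : Fin n) (f : H) (z : D), ι (M i f) z = (z : Fin n → ℂ) i • ι f z)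
    (w : Fin n → ℂ) (f : H)
    (hf : ∀ i, ContinuousLinearMap.adjoint (M i) f = conj (w i) • f)
    (v : V) (c : H) (hc : ι c = fun _ => v) (p : MvPolynomial (Fin n) ℂ) :
    ∀ g : H, (ι g = fun z : D => MvPolynomial.eval (z : Fin n → ℂ) p • v) →
      ⟪f, g⟫_ℂ = MvPolynomial.eval w p * ⟪f, c⟫_ℂ := by
  have lift (q : MvPolynomial (Fin n) ℂ) :
      ∃ g : H, ι g = fun z : D => MvPolynomial.eval (z : Fin n → ℂ) q • v :=
    hpoly _ ⟨1, fun _ => q, fun _ => v, fun z => by simp⟩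
  induction p using MvPolynomial.induction_on with
  | C a =>
    intro g hg
    have : g = a • c := hι (by rw [hg, map_smul, hc]; ext z; simp)
    simp [this]
  | add p q hp hq =>
    intro g hg
    obtain ⟨a, ha⟩ := lift p
    obtain ⟨b, hb⟩ := lift q
    have : g = a + b := hι (by rw [hg, map_add, ha, hb]; ext z; simp [add_smul])
    rw [this, inner_add_right, hp a ha, hq b hb, map_add, add_mul]
  | mul_X p i hp =>
    intro g hg
    obtain ⟨a, ha⟩ := lift p
    have : g = M i a := hι (by
      ext z
      rw [hg, hM, ha]
      simp [smul_smul, mul_comm])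
    rw [this, ← ContinuousLinearMap.adjoint_inner_left, hf, inner_smul_left, hp a ha]
    simp only [map_mul, MvPolynomial.eval_X, RingHomCompTriple.comp_apply, RingHom.id_apply]
    ring

/-- Let `D ⊆ ℂⁿ`, `V` finite-dimensional, and `H` a Hilbert space of
`V`-valued functions on `D` with reproducing kernel `K`, containing the `V`-valued polynomials
as a dense subset, and on which each coordinate multiplication operator `M_i` is bounded.
Then for every `w ∈ D` the joint eigenspace `{f : M_i⋆ f = conj(w_i) f, 1 ≤ i ≤ n}` equals
`{K(·,w) v : v ∈ V}`; in particular `M_i⋆ (K(·,w) v) = conj(w_i) K(·,w) v`. -/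
theorem stmt_12 {n : ℕ}
    (D : Set (Fin n → ℂ)) (hDne : D.Nonempty)
    {V : Type*} [NormedAddCommGroup V] [InnerProductSpace ℂ V] [FiniteDimensional ℂ V]
    {H : Type*} [NormedAddCommGroup H] [InnerProductSpace ℂ H] [CompleteSpace H]
    (ι : H →ₗ[ℂ] (D → V)) (hι : Function.Injective ι)
    -- reproducing kernel data for `H`
    (K : D → D → (V →L[ℂ] V)) (kfun : D → V → H)
    (hKrep : ∀ (w : D) (v : V), ι (kfun w v) = fun z => K z w v)
    (hKprop : ∀ (w : D) (v : V) (f : H), ⟪kfun w v, f⟫_ℂ = ⟪v, ι f w⟫_ℂ)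
    -- every `V`-valued polynomial function (restricted to `D`) belongs to `H` ...
    (hpoly : ∀ F : D → V, IsPolyFun F → ∃ f : H, ι f = F)
    -- ... and the polynomials are dense in `H`
    (hdense : Dense {f : H | IsPolyFun (ι f)})
    -- each coordinate multiplication operator is bounded on `H`
    (M : Fin n → (H →L[ℂ] H))
    (hM : ∀ (i : Fin n) (f : H) (z : D), ι (M i f) z = (z : Fin n → ℂ) i • ι f z) :
    -- the joint eigenspace of the adjoints at `conj w` is exactly `{K(·,w) v : v ∈ V}` ...
    (∀ (w : D) (f : H),
      (∀ i, ContinuousLinearMap.adjoint (M i) f = conj ((w : Fin n → ℂ) i) • f) ↔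
      (∃ v : V, f = kfun w v)) ∧
    -- ... in particular each `K(·,w) v` is a joint eigenvector
    (∀ (w : D) (v : V) (i : Fin n),
      ContinuousLinearMap.adjoint (M i) (kfun w v)
        = conj ((w : Fin n → ℂ) i) • kfun w v) := by
  have eig (w : D) (v : V) (i : Fin n) :
      ContinuousLinearMap.adjoint (M i) (kfun w v)
        = conj ((w : Fin n → ℂ) i) • kfun w v := by
    refine ext_inner_right ℂ fun g => ?_
    rw [ContinuousLinearMap.adjoint_inner_left, hKprop, hM, inner_smul_left, hKprop,
      inner_smul_right, Complex.conj_conj]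
  refine ⟨fun w f => ⟨fun hf => ?_, ?_⟩, eig⟩
  · have hconst (v : V) : ∃ c : H, ι c = fun _ => v :=
      hpoly _ ⟨1, fun _ => 1, fun _ => v, fun z => by simp⟩
    choose c hc using hconst
    let φ : V →ₗ[ℂ] ℂ :=
      { toFun := fun v => ⟪f, c v⟫_ℂ
        map_add' := fun u v => by
          have : c (u + v) = c u + c v := hι (by rw [map_add, hc, hc, hc]; rfl)
          rw [this, inner_add_right]
        map_smul' := fun a v => by
          have : c (a • v) = a • c v := hι (by rw [map_smul, hc, hc]; rfl)
          rw [this, inner_smul_right]; rfl }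
    let v₀ : V := (InnerProductSpace.toDual ℂ V).symm (LinearMap.toContinuousLinearMap φ)
    have hv₀ (v : V) : ⟪v₀, v⟫_ℂ = ⟪f, c v⟫_ℂ := by
      simp [v₀, φ]
    refine ⟨v₀, hdense.eq_of_inner_left (𝕜 := ℂ) fun g hg => ?_⟩
    obtain ⟨N, p, v, hg⟩ := hg
    have lift (j : Fin N) :
        ∃ a : H, ι a = fun z : D => MvPolynomial.eval (z : Fin n → ℂ) (p j) • v j :=
      hpoly _ ⟨1, fun _ => p j, fun _ => v j, fun z => by simp⟩
    choose a ha using lift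
    have hsum : g = ∑ j, a j := hι (by
      ext z
      simp [hg, ha])
    rw [hKprop, hg, inner_sum, hsum, inner_sum]
    refine Finset.sum_congr rfl fun j _ => ?_
    rw [inner_smul_right, hv₀]
    exact inner_eq_eval_mul_of_adjoint_eigenvector ι hι hpoly M hM w f hf (v j) (c (v j))
      (hc (v j)) (p j) (a j) (ha j)
  · rintro ⟨v, rfl⟩ i
    exact eig w v i
end

section
/- Let u, w₀, λ be real numbers and n a positive integer, and set c_j = u + (j−1) w₀ − λ/(2n) for every integer j ≥ 1. Fix integers 0 ≤ j ≤ ℓ and assume the regularity condition c_{j+1} + c_{j+k} ≠ 0 for all 1 ≤ k ≤ ℓ+1−j. For j ≤ i ≤ ℓ+1 define c_{i,j} = (2^{i−j} / (i−j)!) · Π_{k=1}^{i−j} (c_{j+1} + c_{j+k})^{−1} (so that c_{j,j} = 1), and set c_{j−1,j} = 0. Then for every i with j ≤ i ≤ ℓ one has the identity ((ℓ−i+1)/2) · c_{i,j} · (c_{i+1} + c_{ℓ+1}) + c_{i−1,j} = (c_{ℓ,j} / c_{ℓ+1,j}) · c_{i,j}. -/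
/-- Let `u, w₀, λ ∈ ℝ`, `n ≥ 1`, and `c_j = u + (j−1) w₀ − λ/(2n)` for
`j ≥ 1`.  Fix `0 ≤ j ≤ ℓ` and assume the regularity condition `c_{j+1} + c_{j+k} ≠ 0` for
`1 ≤ k ≤ ℓ+1−j`.  For `j ≤ i ≤ ℓ+1`, let
`c_{i,j} = (2^{i−j} / (i−j)!) ∏_{k=1}^{i−j} (c_{j+1} + c_{j+k})⁻¹` (so `c_{j,j} = 1`) and set
`c_{j−1,j} = 0`.  Then for every `j ≤ i ≤ ℓ`:
`((ℓ−i+1)/2) c_{i,j} (c_{i+1} + c_{ℓ+1}) + c_{i−1,j} = (c_{ℓ,j}/c_{ℓ+1,j}) c_{i,j}`. -/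
theorem stmt_14 (u w₀ lam : ℝ) (n : ℕ) (hn : 0 < n)
    (c : ℕ → ℝ)
    (hc : ∀ j : ℕ, 1 ≤ j → c j = u + ((j : ℝ) - 1) * w₀ - lam / (2 * n))
    (j ℓ : ℕ) (hjl : j ≤ ℓ)
    (hreg : ∀ k : ℕ, 1 ≤ k → k ≤ ℓ + 1 - j → c (j + 1) + c (j + k) ≠ 0)
    (C : ℕ → ℝ)
    (hC : ∀ i : ℕ, j ≤ i → i ≤ ℓ + 1 →
      C i = (2 ^ (i - j) / (Nat.factorial (i - j) : ℝ)) *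
        ∏ k ∈ Finset.Icc 1 (i - j), (c (j + 1) + c (j + k))⁻¹) :
    ∀ i : ℕ, j ≤ i → i ≤ ℓ →
      ((ℓ : ℝ) - (i : ℝ) + 1) / 2 * C i * (c (i + 1) + c (ℓ + 1))
          + (if i = j then 0 else C (i - 1))
        = C ℓ / C (ℓ + 1) * C i := by
  have hstep : ∀ i : ℕ, j ≤ i → i ≤ ℓ →
      C i = ((i : ℝ) - j + 1) * (c (j + 1) + c (i + 1)) / 2 * C (i + 1) := by
    intro i hji hil
    obtain ⟨m, rfl⟩ := Nat.exists_eq_add_of_le hji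
    have hr : c (j + 1) + c (j + m + 1) ≠ 0 := hreg (m + 1) (by omega) (by omega)
    rw [hC (j + m) hji (by omega), hC (j + m + 1) (by omega) (by omega),
      show j + m - j = m by omega, show j + m + 1 - j = m + 1 by omega,
      Finset.prod_Icc_succ_top (by omega), Nat.factorial_succ, ← add_assoc j m 1]
    have hf : (m.factorial : ℝ) ≠ 0 := by positivity
    have hm : (m : ℝ) + 1 ≠ 0 := by positivity
    push_cast
    rw [add_sub_cancel_left]
    field_simp
    ring
  have hne : C (ℓ + 1) ≠ 0 := by
    rw [hC (ℓ + 1) (by omega) le_rfl]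
    refine mul_ne_zero (by positivity) (Finset.prod_ne_zero_iff.mpr fun k hk => ?_)
    rw [Finset.mem_Icc] at hk
    exact inv_ne_zero (hreg k hk.1 hk.2)
  intro i hji hil
  have hprev : (if i = j then 0 else C (i - 1))
      = ((i : ℝ) - j) * (c (j + 1) + c i) / 2 * C i := by
    split_ifs with h
    · simp [h]
    · obtain ⟨p, rfl⟩ : ∃ p, i = p + 1 := ⟨i - 1, by omega⟩
      rw [Nat.add_sub_cancel, hstep p (by omega) (by omega)]
      push_cast
      ring
  rw [hprev, hstep ℓ hjl le_rfl, mul_div_cancel_right₀ _ hne]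
  rcases Nat.eq_zero_or_pos i with rfl | hi
  · obtain rfl : j = 0 := by omega
    rw [hc (0 + 1) (by omega), hc (ℓ + 1) (by omega)]
    push_cast
    ring
  · rw [hc (j + 1) (by omega), hc (ℓ + 1) (by omega), hc (i + 1) (by omega), hc i hi]
    push_cast
    ring
end
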